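/- Let n_1,…,n_r be positive integers with n_r ≥ 2 and set w = n_1 + ⋯ + n_r. Define g_i(t) = 1/(1−t) if i ∈ {1, 1+n_1, 1+n_1+n_2, …, 1+n_1+⋯+n_{r−1}} and g_i(t) = 1/t otherwise (for 1 ≤ i ≤ w). Then ∫_{0<t_1<⋯<t_w<1} ∏_{i=1}^w g_i(t_i) dt_1⋯dt_w = ζ(n_1,…,n_r), the integral converging absolutely. -/

import Mathlib

open MeasureTheory

/-- The multiple zeta value ζ(n₁,…,n_r) = Σ_{0<k₁<…<k_r} ∏ᵢ 1/kᵢ^{nᵢ}. -/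
noncomputable def mzv {r : ℕ} (n : Fin r → ℕ) : ℝ :=
  ∑' k : {k : Fin r → ℕ // StrictMono k ∧ ∀ i, 0 < k i}, ∏ i, (1 : ℝ) / (k.1 i : ℝ) ^ (n i)

/-- The open simplex 0 < t₁ < ⋯ < t_w < 1. -/
def openSimplex (w : ℕ) : Set (Fin w → ℝ) :=
  {t | (∀ i, 0 < t i ∧ t i < 1) ∧ ∀ i j : Fin w, i < j → t i < t j}

open scoped Classical in
/-- The letter: `1/(1-t)` or `1/t`. -/
noncomputable def letterFn (c : ℕ → Prop) (i : ℕ) (t : ℝ) : ENNReal :=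
  ENNReal.ofReal (if c i then (1 - t)⁻¹ else t⁻¹)

/-- Iterated integral. -/
noncomputable def iterInt (c : ℕ → Prop) : ℕ → ℝ → ENNReal
  | 0, _ => 1
  | w + 1, x => ∫⁻ s in Set.Ioo 0 x, letterFn c w s * iterInt c w s

/-- Simplex of size `x`. -/
def simplexUpTo (w : ℕ) (x : ℝ) : Set (Fin w → ℝ) :=
  {t | (∀ i, 0 < t i ∧ t i < x) ∧ ∀ i j : Fin w, i < j → t i < t j}

lemma measurableSet_simplexUpTo (w : ℕ) (x : ℝ) : MeasurableSet (simplexUpTo w x) := by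
  unfold simplexUpTo
  have h : {t : Fin w → ℝ | (∀ i, 0 < t i ∧ t i < x) ∧ ∀ i j : Fin w, i < j → t i < t j}
    = (⋂ i, ({t | 0 < t i} ∩ {t | t i < x})) ∩ ⋂ i, ⋂ j, ⋂ (_ : i < j), {t | t i < t j} := by
    ext t; simp
  rw [h]
  refine MeasurableSet.inter (MeasurableSet.iInter fun i => MeasurableSet.inter ?_ ?_)
    (MeasurableSet.iInter fun i => MeasurableSet.iInter fun j => MeasurableSet.iInter fun _ => ?_)
  · exact measurableSet_lt measurable_const (measurable_pi_apply i)
  · exact measurableSet_lt (measurable_pi_apply i) measurable_const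
  · exact measurableSet_lt (measurable_pi_apply i) (measurable_pi_apply j)

lemma measurable_letterFn (c : ℕ → Prop) (i : ℕ) : Measurable (letterFn c i) := by
  unfold letterFn
  by_cases h : c i
  · simp only [h, if_true]; fun_prop
  · simp only [h, if_false]; fun_prop

lemma insert_mem_simplexUpTo (w : ℕ) (x s : ℝ) (u : Fin w → ℝ) :
    (Fin.snoc u s : Fin (w + 1) → ℝ) ∈ simplexUpTo (w + 1) x ↔
      s ∈ Set.Ioo 0 x ∧ u ∈ simplexUpTo w s := by
  simp only [simplexUpTo, Set.mem_ofPred_eq, Set.mem_Ioo, Fin.forall_fin_succ', Fin.snoc_castSucc,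
    Fin.snoc_last, Fin.castSucc_lt_castSucc_iff, Fin.castSucc_lt_last, forall_true_left]
  constructor
  · rintro ⟨⟨h1, h2⟩, h3, h4⟩
    exact ⟨h2, fun i => ⟨(h1 i).1, (h3 i).2⟩, fun i j hij => (h3 i).1 j hij⟩
  · rintro ⟨h1, h2, h3⟩
    refine ⟨⟨fun i => ⟨(h2 i).1, (h2 i).2.trans h1.2⟩, h1⟩,
      fun i => ⟨fun j hij => h3 i j hij, (h2 i).2⟩, ?_, ?_⟩
    · intro i hi; exact absurd hi (not_lt.2 (Fin.le_last _))
    · intro h; exact absurd h (lt_irrefl _)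

lemma lintegral_simplexUpTo (c : ℕ → Prop) (w : ℕ) (x : ℝ) :
    ∫⁻ t in simplexUpTo w x, ∏ i : Fin w, letterFn c i (t i) = iterInt c w x := by
  induction w generalizing x with
  | zero =>
    have : simplexUpTo 0 x = Set.univ := by
      ext t; simp [simplexUpTo]
    simp [this, iterInt, volume_pi]
  | succ w ih =>
    have hm : ∀ w, Measurable (fun t : Fin w → ℝ => ∏ i : Fin w, letterFn c i (t i)) := fun w =>
      Finset.measurable_prod _ fun i _ => (measurable_letterFn c i).comp (measurable_pi_apply i)
    rw [← lintegral_indicator (measurableSet_simplexUpTo _ _)]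
    have hF : Measurable ((simplexUpTo (w + 1) x).indicator
      (fun t : Fin (w + 1) → ℝ => ∏ i : Fin (w + 1), letterFn c i (t i))) :=
      (hm (w + 1)).indicator (measurableSet_simplexUpTo _ _)
    have mp := (volume_preserving_piFinSuccAbove (fun _ : Fin (w + 1) => ℝ) (Fin.last w)).symm
    rw [← mp.lintegral_comp hF, Measure.volume_eq_prod,
      lintegral_prod _ (by exact (hF.comp mp.measurable).aemeasurable)]
    rw [iterInt, ← lintegral_indicator measurableSet_Ioo]
    refine lintegral_congr fun s => ?_
    have key : ∀ u : Fin w → ℝ,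
        (MeasurableEquiv.piFinSuccAbove (fun _ : Fin (w + 1) => ℝ) (Fin.last w)).symm (s, u)
          = (Fin.snoc u s : Fin (w + 1) → ℝ) := by
      intro u
      simp [MeasurableEquiv.piFinSuccAbove, Fin.insertNthEquiv, Fin.insertNth_last']
    simp only [key]
    by_cases hs : s ∈ Set.Ioo 0 x
    · rw [Set.indicator_of_mem hs, ← ih s, ← lintegral_const_mul _ (hm w),
        ← lintegral_indicator (measurableSet_simplexUpTo _ _)]
      refine lintegral_congr fun u => ?_
      by_cases hu : u ∈ simplexUpTo w s
      · rw [Set.indicator_of_mem hu,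
          Set.indicator_of_mem ((insert_mem_simplexUpTo w x s u).2 ⟨hs, hu⟩),
          Fin.prod_univ_castSucc, mul_comm]
        simp
      · rw [Set.indicator_of_notMem hu, Set.indicator_of_notMem]
        exact fun h => hu ((insert_mem_simplexUpTo w x s u).1 h).2
    · rw [Set.indicator_of_notMem hs]
      rw [← lintegral_zero (μ := (volume : Measure (Fin w → ℝ)))]
      refine lintegral_congr fun u => ?_
      rw [Set.indicator_of_notMem]
      exact fun h => hs ((insert_mem_simplexUpTo w x s u).1 h).1

open scoped Classical in
/-- Coefficients of the power series of the iterated integral. -/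
noncomputable def coeffs (c : ℕ → Prop) : ℕ → ℕ → ENNReal
  | 0, m => if m = 0 then 1 else 0
  | w + 1, m => if c w then (∑ j ∈ Finset.range m, coeffs c w j) / m else coeffs c w m / m

lemma coeffs_zero (c : ℕ → Prop) (h0 : c 0) (w : ℕ) : coeffs c (w + 1) 0 = 0 := by
  induction w with
  | zero => simp [coeffs, h0]
  | succ w ih =>
    rw [coeffs]
    split_ifs
    · simp
    · simp [ih]

lemma lintegral_pow_Ioo (m : ℕ) (x : ℝ) (hx : 0 ≤ x) :
    ∫⁻ t in Set.Ioo 0 x, ENNReal.ofReal t ^ m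
      = ENNReal.ofReal x ^ (m + 1) / ((m + 1 : ℕ) : ENNReal) := by
  have h1 : ∫⁻ t in Set.Ioo 0 x, ENNReal.ofReal t ^ m
      = ∫⁻ t in Set.Ioo 0 x, ENNReal.ofReal (t ^ m) :=
    setLIntegral_congr_fun measurableSet_Ioo fun t ht => (ENNReal.ofReal_pow ht.1.le m).symm
  rw [h1, ← ofReal_integral_eq_lintegral_ofReal]
  · rw [← integral_Ioc_eq_integral_Ioo, ← intervalIntegral.integral_of_le hx, integral_pow,
      ← ENNReal.ofReal_pow hx, ENNReal.ofReal_div_of_pos (by positivity)]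
    congr 1
    · simp
    · rw [← Nat.cast_succ, ENNReal.ofReal_natCast]
  · exact ((continuous_pow m).integrableOn_Icc (a := 0) (b := x)).mono_set Set.Ioo_subset_Icc_self
  · filter_upwards [ae_restrict_mem measurableSet_Ioo] with t ht
    exact pow_nonneg ht.1.le m

lemma tsum_shift (m : ℕ) (h : ℕ → ENNReal) :
    ∑' j, h (m + j + 1) = ∑' N, if m < N then h N else 0 := by
  have hi : Function.Injective (fun j : ℕ => m + j + 1) := fun a b hab => by
    simp only at hab; omega
  rw [← hi.tsum_eq (f := fun N => if m < N then h N else 0)]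
  · refine tsum_congr fun j => ?_
    rw [if_pos (by omega)]
  · intro N hN
    by_cases hmN : m < N
    · exact ⟨N - m - 1, by simp only; omega⟩
    · simp [hmN] at hN

lemma iterInt_eq (c : ℕ → Prop) (h0 : c 0) (w : ℕ) (x : ℝ) (hx0 : 0 < x) (hx : x ≤ 1) :
    iterInt c w x = ∑' m, coeffs c w m * ENNReal.ofReal x ^ m := by
  induction w generalizing x with
  | zero =>
    rw [tsum_eq_single 0]
    · simp [coeffs, iterInt]
    · intro m hm; simp [coeffs, hm]
  | succ w ih =>
    rw [iterInt]
    have e1 : ∫⁻ s in Set.Ioo 0 x, letterFn c w s * iterInt c w s =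
        ∫⁻ s in Set.Ioo 0 x, letterFn c w s * ∑' m, coeffs c w m * ENNReal.ofReal s ^ m :=
      setLIntegral_congr_fun measurableSet_Ioo fun s hs => by
        simp only [ih s hs.1 (hs.2.le.trans hx)]
    rw [e1]
    by_cases hc : c w
    · have e2 : ∫⁻ s in Set.Ioo 0 x, letterFn c w s * ∑' m, coeffs c w m * ENNReal.ofReal s ^ m
          = ∫⁻ s in Set.Ioo 0 x, ∑' m, ∑' j, coeffs c w m * ENNReal.ofReal s ^ (m + j) := by
        refine setLIntegral_congr_fun measurableSet_Ioo fun s hs => ?_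
        have hs1 : s < 1 := hs.2.trans_le hx
        have : letterFn c w s = ∑' j, ENNReal.ofReal s ^ j := by
          rw [ENNReal.tsum_geometric, letterFn, if_pos hc,
            ENNReal.ofReal_inv_of_pos (by linarith), ENNReal.ofReal_sub _ hs.1.le,
            ENNReal.ofReal_one]
        simp only [this]
        rw [← ENNReal.tsum_mul_left]
        refine tsum_congr fun m => ?_
        rw [← ENNReal.tsum_mul_right]
        refine tsum_congr fun j => ?_
        rw [pow_add]; ring
      rw [e2, lintegral_tsum (fun m => by fun_prop)]
      have e3 : ∀ m, ∫⁻ s in Set.Ioo 0 x, ∑' j, coeffs c w m * ENNReal.ofReal s ^ (m + j)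
          = ∑' N, if m < N then coeffs c w m * (ENNReal.ofReal x ^ N / (N : ENNReal)) else 0 := by
        intro m
        rw [lintegral_tsum (fun m => by fun_prop),
          ← tsum_shift m (fun N => coeffs c w m * (ENNReal.ofReal x ^ N / (N : ENNReal)))]
        refine tsum_congr fun j => ?_
        rw [lintegral_const_mul _ (by fun_prop), lintegral_pow_Ioo _ _ hx0.le]
      simp only [e3]
      rw [ENNReal.tsum_comm]
      refine tsum_congr fun N => ?_
      rw [coeffs, if_pos hc, tsum_eq_sum (s := Finset.range N), div_eq_mul_inv (∑ j ∈ _, _), Finset.sum_mul,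
        Finset.sum_mul]
      · refine Finset.sum_congr rfl fun m hm => ?_
        rw [if_pos (Finset.mem_range.1 hm), div_eq_mul_inv]; ring
      · intro m hm
        rw [if_neg (by simpa using hm)]
    · obtain ⟨v, rfl⟩ : ∃ v, w = v + 1 := by
        cases w with
        | zero => exact absurd h0 hc
        | succ v => exact ⟨v, rfl⟩
      have e2 : ∫⁻ s in Set.Ioo 0 x,
            letterFn c (v + 1) s * ∑' m, coeffs c (v + 1) m * ENNReal.ofReal s ^ m
          = ∫⁻ s in Set.Ioo 0 x, ∑' m, coeffs c (v + 1) (m + 1) * ENNReal.ofReal s ^ m := by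
        refine setLIntegral_congr_fun measurableSet_Ioo fun s hs => ?_
        have : letterFn c (v + 1) s = (ENNReal.ofReal s)⁻¹ := by
          rw [letterFn, if_neg hc, ENNReal.ofReal_inv_of_pos hs.1]
        simp only [this]
        rw [tsum_eq_zero_add' ENNReal.summable, coeffs_zero c h0, zero_mul, zero_add,
          ← ENNReal.tsum_mul_left]
        refine tsum_congr fun m => ?_
        have hne : ENNReal.ofReal s ≠ 0 := by simpa using hs.1
        rw [pow_succ, mul_comm, mul_assoc, mul_assoc,
          ENNReal.mul_inv_cancel hne ENNReal.ofReal_ne_top, mul_one]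
      rw [e2, lintegral_tsum (fun m => by fun_prop), tsum_eq_zero_add' (f := fun m => coeffs c (v + 1 + 1) m * _) ENNReal.summable,
        coeffs_zero c h0, zero_mul, zero_add]
      refine tsum_congr fun m => ?_
      rw [lintegral_const_mul _ (by fun_prop), lintegral_pow_Ioo _ _ hx0.le,
        show coeffs c (v + 1 + 1) (m + 1)
          = coeffs c (v + 1) (m + 1) / ((m + 1 : ℕ) : ENNReal) by rw [coeffs, if_neg hc],
        div_eq_mul_inv, div_eq_mul_inv]
      ring

open scoped Classical in
/-- Truncated multiple zeta sums. -/
noncomputable def truncZeta (N : ℕ → ℕ) (r : ℕ) (M : ℕ∞) : ENNReal :=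
  ∑' k : Fin r → ℕ, if (StrictMono k ∧ ∀ i, 0 < k i) ∧ ∀ i, (k i : ℕ∞) < M
    then ∏ i, ((k i : ENNReal) ^ N i)⁻¹ else 0

lemma truncZeta_zero (N : ℕ → ℕ) (M : ℕ∞) : truncZeta N 0 M = 1 := by
  unfold truncZeta
  rw [tsum_eq_single default]
  · rw [if_pos]
    · simp
    · exact ⟨⟨fun i => i.elim0, fun i => i.elim0⟩, fun i => i.elim0⟩
  · intro k hk; exact absurd (Subsingleton.elim _ _) hk

lemma snoc_cond (r m : ℕ) (k : Fin r → ℕ) (M : ℕ∞) :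
    ((StrictMono (Fin.snoc k m : Fin (r + 1) → ℕ) ∧ ∀ i, 0 < (Fin.snoc k m : Fin (r + 1) → ℕ) i) ∧
      ∀ i, ((Fin.snoc k m : Fin (r + 1) → ℕ) i : ℕ∞) < M) ↔
    (0 < m ∧ (m : ℕ∞) < M) ∧ ((StrictMono k ∧ ∀ i, 0 < k i) ∧ ∀ i, (k i : ℕ∞) < (m : ℕ∞)) := by
  simp only [StrictMono, Fin.forall_fin_succ', Fin.snoc_castSucc, Fin.snoc_last,
    Fin.castSucc_lt_castSucc_iff, Fin.castSucc_lt_last, forall_true_left, Nat.cast_lt]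
  constructor
  · rintro ⟨⟨⟨h1, h2⟩, h3, h4⟩, h5, h6⟩
    exact ⟨⟨h4, h6⟩, ⟨fun i j hij => (h1 i).1 j hij, h3⟩, fun i => (h1 i).2⟩
  · rintro ⟨⟨h4, h6⟩, ⟨h1, h3⟩, h2⟩
    refine ⟨⟨⟨fun i => ⟨fun j hij => h1 hij, h2 i⟩, ?_, ?_⟩, h3, h4⟩, ?_, h6⟩
    · intro i hi; exact absurd hi (not_lt.2 (Fin.le_last _))
    · intro h; exact absurd h (lt_irrefl _)
    · intro i
      exact lt_trans (by exact_mod_cast h2 i) h6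

open scoped Classical in
lemma truncZeta_succ (N : ℕ → ℕ) (r : ℕ) (M : ℕ∞) :
    truncZeta N (r + 1) M = ∑' m : ℕ, if 0 < m ∧ (m : ℕ∞) < M
      then truncZeta N r m * ((m : ENNReal) ^ N r)⁻¹ else 0 := by
  conv_lhs => unfold truncZeta
  rw [← (Fin.snocEquiv (fun _ : Fin (r + 1) => ℕ)).tsum_eq, ENNReal.tsum_prod']
  refine tsum_congr fun m => ?_
  have key : ∀ k : Fin r → ℕ, (Fin.snocEquiv (fun _ : Fin (r + 1) => ℕ)) (m, k)
      = (Fin.snoc k m : Fin (r + 1) → ℕ) := fun k => rfl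
  simp only [key, snoc_cond]
  by_cases hm : 0 < m ∧ (m : ℕ∞) < M
  · rw [if_pos hm, truncZeta, ← ENNReal.tsum_mul_right]
    refine tsum_congr fun k => ?_
    simp only [hm, true_and]
    split_ifs
    · rw [Fin.prod_univ_castSucc]; simp
    · simp
  · rw [if_neg hm]; simp only [hm, false_and, if_false, tsum_zero]

lemma truncZeta_mono (N : ℕ → ℕ) (r : ℕ) {M M' : ℕ∞} (h : M ≤ M') :
    truncZeta N r M ≤ truncZeta N r M' := by
  classical
  refine ENNReal.tsum_le_tsum fun k => ?_
  split_ifs with h1 h2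
  · exact le_rfl
  · exact absurd ⟨h1.1, fun i => (h1.2 i).trans_le h⟩ h2
  · exact zero_le
  · exact le_rfl

lemma truncZeta_succ_nat (N : ℕ → ℕ) (r M : ℕ) :
    truncZeta N (r + 1) M = ∑ m ∈ Finset.range M, if 0 < m
      then truncZeta N r m * ((m : ENNReal) ^ N r)⁻¹ else 0 := by
  rw [truncZeta_succ, tsum_eq_sum (s := Finset.range M)]
  · refine Finset.sum_congr rfl fun m hm => ?_
    have : (m : ℕ∞) < M := by exact_mod_cast Finset.mem_range.1 hm
    simp only [this, and_true]
  · intro m hm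
    rw [if_neg]
    rintro ⟨_, h⟩
    exact hm (Finset.mem_range.2 (by exact_mod_cast h))

lemma coeffs_block (c : ℕ → Prop) (p q l : ℕ) (hp : c p) (hq : ∀ i, p < i → i < q → ¬ c i)
    (hl : p + 1 + l ≤ q) (m : ℕ) :
    coeffs c (p + 1 + l) m
      = (∑ j ∈ Finset.range m, coeffs c p j) * ((m : ENNReal) ^ (l + 1))⁻¹ := by
  induction l with
  | zero => rw [add_zero, coeffs, if_pos hp, div_eq_mul_inv]; simp
  | succ l ih =>
    rw [← add_assoc, coeffs, if_neg (hq _ (by omega) (by omega)), ih (by omega), div_eq_mul_inv,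
      mul_assoc, ← ENNReal.mul_inv (Or.inr (ENNReal.natCast_ne_top m))
        (Or.inl (ENNReal.pow_ne_top (ENNReal.natCast_ne_top m))), ← pow_succ]

/-- Partial sums. -/
def pSum (N : ℕ → ℕ) (j : ℕ) : ℕ := ∑ k ∈ Finset.range j, N k

lemma coeffs_pSum_succ (N : ℕ → ℕ) (hN : ∀ i, 1 ≤ N i) (r m : ℕ) :
    coeffs (fun i => ∃ j, i = pSum N j) (pSum N (r + 1)) m =
      (∑ j ∈ Finset.range m, coeffs (fun i => ∃ j, i = pSum N j) (pSum N r) j)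
        * ((m : ENNReal) ^ N r)⁻¹ := by
  have hsucc : ∀ j, pSum N (j + 1) = pSum N j + N j := fun j => Finset.sum_range_succ _ _
  have hmono : StrictMono (pSum N) := strictMono_nat_of_lt_succ fun j => by
    rw [hsucc]; have := hN j; omega
  have h1 : N r = (N r - 1) + 1 := by have := hN r; omega
  have h2 : pSum N (r + 1) = pSum N r + 1 + (N r - 1) := by rw [hsucc]; omega
  have := coeffs_block (fun i => ∃ j, i = pSum N j) (pSum N r) (pSum N (r + 1)) (N r - 1) ⟨r, rfl⟩
    (by
      rintro i hi1 hi2 ⟨j, rfl⟩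
      have a1 := hmono.lt_iff_lt.1 hi1
      have a2 := hmono.lt_iff_lt.1 hi2
      omega) h2.ge m
  rw [← h2, ← h1] at this
  exact this

lemma sum_coeffs (N : ℕ → ℕ) (hN : ∀ i, 1 ≤ N i) (r M : ℕ) (hM : 0 < M) :
    ∑ j ∈ Finset.range M, coeffs (fun i => ∃ j, i = pSum N j) (pSum N r) j
      = truncZeta N r M := by
  induction r generalizing M with
  | zero =>
    rw [truncZeta_zero]
    simp [pSum, coeffs, hM]
  | succ r ih =>
    rw [truncZeta_succ_nat]
    refine Finset.sum_congr rfl fun m _ => ?_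
    rw [coeffs_pSum_succ N hN]
    split_ifs with hm
    · rw [ih m hm]
    · obtain rfl : m = 0 := by omega
      simp

lemma tsum_coeffs (N : ℕ → ℕ) (hN : ∀ i, 1 ≤ N i) (r : ℕ) :
    ∑' m, coeffs (fun i => ∃ j, i = pSum N j) (pSum N (r + 1)) m = truncZeta N (r + 1) ⊤ := by
  rw [truncZeta_succ]
  refine tsum_congr fun m => ?_
  rw [coeffs_pSum_succ N hN]
  split_ifs with hm
  · rw [sum_coeffs N hN r m hm.1]
  · obtain rfl : m = 0 := by simpa using hm
    simp

lemma harm_bound (M : ℕ) :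
    (∑ m ∈ Finset.range M, if 0 < m then (m : ENNReal)⁻¹ else 0)
      ≤ ENNReal.ofReal (1 + Real.log M) := by
  calc (∑ m ∈ Finset.range M, if 0 < m then (m : ENNReal)⁻¹ else 0)
      ≤ ∑ m ∈ Finset.range (M + 1), if 0 < m then (m : ENNReal)⁻¹ else 0 :=
        Finset.sum_le_sum_of_subset (Finset.range_mono (Nat.le_succ M))
    _ = ∑ m ∈ Finset.range M, ENNReal.ofReal (((m + 1 : ℕ) : ℝ)⁻¹) := by
        rw [Finset.sum_range_succ']
        simp only [Nat.succ_pos, if_true, lt_irrefl, if_false, add_zero]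
        refine Finset.sum_congr rfl fun m _ => ?_
        rw [ENNReal.ofReal_inv_of_pos (by positivity), ENNReal.ofReal_natCast]
    _ = ENNReal.ofReal (harmonic M : ℝ) := by
        rw [← ENNReal.ofReal_sum_of_nonneg (fun i _ => by positivity)]
        congr 1
        simp [harmonic]
    _ ≤ _ := ENNReal.ofReal_le_ofReal (harmonic_le_one_add_log M)

lemma truncZeta_le (N : ℕ → ℕ) (hN : ∀ i, 1 ≤ N i) (r M : ℕ) :
    truncZeta N r M ≤ ENNReal.ofReal (1 + Real.log M) ^ r := by
  induction r with
  | zero => rw [truncZeta_zero, pow_zero]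
  | succ r ih =>
    rw [truncZeta_succ_nat]
    calc _ ≤ ∑ m ∈ Finset.range M, truncZeta N r M * (if 0 < m then (m : ENNReal)⁻¹ else 0) := by
          refine Finset.sum_le_sum fun m hm => ?_
          split_ifs with h
          · refine mul_le_mul' (truncZeta_mono N r ?_) ?_
            · exact_mod_cast (Finset.mem_range.1 hm).le
            · rw [ENNReal.inv_le_inv]
              exact le_self_pow₀ (by exact_mod_cast h) (by have := hN r; omega)
          · simp
      _ = truncZeta N r M * ∑ m ∈ Finset.range M, (if 0 < m then (m : ENNReal)⁻¹ else 0) := by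
          rw [Finset.mul_sum]
      _ ≤ ENNReal.ofReal (1 + Real.log M) ^ r * ENNReal.ofReal (1 + Real.log M) :=
          mul_le_mul' ih (harm_bound M)
      _ = _ := (pow_succ _ _).symm

lemma log_pow_bound (r : ℕ) (x : ℝ) (hx : 1 ≤ x) :
    (1 + Real.log x) ^ r ≤ (1 + 2 * (r + 1)) ^ r * x ^ (1 / 2 : ℝ) := by
  have hr : (0 : ℝ) < 1 / (2 * (r + 1)) := by positivity
  have h1 := Real.log_le_rpow_div (zero_le_one.trans hx) hr
  have h2 : 1 ≤ x ^ (1 / (2 * (r + 1)) : ℝ) := Real.one_le_rpow hx hr.le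
  have h0 := Real.log_nonneg hx
  have h3 : 1 + Real.log x ≤ (1 + 2 * (r + 1)) * x ^ (1 / (2 * (r + 1)) : ℝ) := by
    rw [div_div_eq_mul_div, div_one] at h1
    linarith
  calc (1 + Real.log x) ^ r ≤ ((1 + 2 * (r + 1)) * x ^ (1 / (2 * (r + 1)) : ℝ)) ^ r :=
        pow_le_pow_left₀ (by linarith) h3 r
    _ = (1 + 2 * (r + 1)) ^ r * x ^ (1 / (2 * (r + 1)) * r : ℝ) := by
        rw [mul_pow, ← Real.rpow_natCast (x ^ _), ← Real.rpow_mul (by linarith)]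
    _ ≤ _ := by
        refine mul_le_mul_of_nonneg_left (Real.rpow_le_rpow_of_exponent_le hx ?_) (by positivity)
        rw [div_mul_eq_mul_div, div_le_div_iff₀ (by positivity) (by positivity)]
        linarith

lemma truncZeta_ne_top (N : ℕ → ℕ) (hN : ∀ i, 1 ≤ N i) (r : ℕ) (hlast : 2 ≤ N r) :
    truncZeta N (r + 1) ⊤ ≠ ⊤ := by
  rw [truncZeta_succ]
  have hs : Summable fun m : ℕ => (1 + 2 * ((r : ℝ) + 1)) ^ r * (m : ℝ) ^ (-(3 / 2) : ℝ) :=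
    (Real.summable_nat_rpow.2 (by norm_num)).mul_left _
  refine ne_top_of_le_ne_top (ENNReal.ofReal_ne_top
    (r := ∑' m : ℕ, (1 + 2 * ((r : ℝ) + 1)) ^ r * (m : ℝ) ^ (-(3 / 2) : ℝ))) ?_
  rw [ENNReal.ofReal_tsum_of_nonneg (fun m => by positivity) hs]
  refine ENNReal.tsum_le_tsum fun m => ?_
  split_ifs with hm
  · have hm1 : (1 : ℝ) ≤ m := by exact_mod_cast hm.1
    have hm0 : (0 : ℝ) < m := by linarith
    calc truncZeta N r m * ((m : ENNReal) ^ N r)⁻¹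
        ≤ ENNReal.ofReal (1 + Real.log m) ^ r * ((m : ENNReal) ^ 2)⁻¹ := by
          refine mul_le_mul' (truncZeta_le N hN r m) ?_
          rw [ENNReal.inv_le_inv]
          exact pow_le_pow_right₀ (by exact_mod_cast hm.1) hlast
      _ = ENNReal.ofReal ((1 + Real.log m) ^ r * ((m : ℝ) ^ 2)⁻¹) := by
          have := Real.log_nonneg hm1
          rw [ENNReal.ofReal_mul (by positivity), ENNReal.ofReal_pow (by positivity),
            ENNReal.ofReal_inv_of_pos (by positivity), ENNReal.ofReal_pow (by positivity),
            ENNReal.ofReal_natCast]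
      _ ≤ _ := by
          apply ENNReal.ofReal_le_ofReal
          have h : (m : ℝ) ^ (-(3 / 2) : ℝ) = (m : ℝ) ^ (1 / 2 : ℝ) * ((m : ℝ) ^ 2)⁻¹ := by
            rw [← Real.rpow_natCast, ← Real.rpow_neg hm0.le, ← Real.rpow_add hm0]
            norm_num
          rw [h, ← mul_assoc]
          exact mul_le_mul_of_nonneg_right (log_pow_bound r m hm1) (by positivity)
  · exact zero_le

lemma mzv_eq (N : ℕ → ℕ) (r : ℕ) :
    mzv (fun i : Fin r => N i) = (truncZeta N r ⊤).toReal := by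
  classical
  have h : truncZeta N r ⊤ = ∑' k : {k : Fin r → ℕ // StrictMono k ∧ ∀ i, 0 < k i},
      ∏ i, ((k.1 i : ENNReal) ^ N i)⁻¹ := by
    have := tsum_subtype {k : Fin r → ℕ | StrictMono k ∧ ∀ i, 0 < k i}
      (fun k : Fin r → ℕ => ∏ i, ((k i : ENNReal) ^ N i)⁻¹)
    refine Eq.trans ?_ this.symm
    unfold truncZeta
    refine tsum_congr fun k => ?_
    simp only [ENat.natCast_lt_top, implies_true, and_true, Set.indicator_apply, Set.mem_ofPred_eq]
  rw [h, ENNReal.tsum_toReal_eq]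
  · unfold mzv
    refine tsum_congr fun k => ?_
    rw [ENNReal.toReal_prod]
    refine Finset.prod_congr rfl fun i _ => ?_
    simp
  · intro k
    refine ENNReal.prod_ne_top fun i _ => ?_
    rw [ENNReal.inv_ne_top]
    exact pow_ne_zero _ (by exact_mod_cast (k.2.2 i).ne')

lemma main_aux (N : ℕ → ℕ) (hN : ∀ i, 1 ≤ N i) (r : ℕ) (hlast : 2 ≤ N r) (W : ℕ)
    (hW : W = pSum N (r + 1)) (f : (Fin W → ℝ) → ℝ)
    (hf : ∀ t ∈ openSimplex W, 0 ≤ f t) (hfm : Measurable f)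
    (hfe : ∀ t ∈ openSimplex W, ENNReal.ofReal (f t) =
      ∏ i : Fin W, letterFn (fun i => ∃ j, i = pSum N j) i (t i)) :
    IntegrableOn f (openSimplex W) ∧
      ∫ t in openSimplex W, f t = mzv (fun i : Fin (r + 1) => N i) := by
  have hS : openSimplex W = simplexUpTo W 1 := rfl
  have hms : MeasurableSet (openSimplex W) := hS ▸ measurableSet_simplexUpTo W 1
  have hl : ∫⁻ t in openSimplex W, ENNReal.ofReal (f t) = truncZeta N (r + 1) ⊤ := by
    rw [setLIntegral_congr_fun hms hfe, hS, lintegral_simplexUpTo,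
      iterInt_eq _ ⟨0, by simp [pSum]⟩ _ _ one_pos le_rfl, hW]
    simp only [ENNReal.ofReal_one, one_pow, mul_one]
    exact tsum_coeffs N hN r
  have hae : 0 ≤ᵐ[volume.restrict (openSimplex W)] f := by
    filter_upwards [ae_restrict_mem hms] with t ht using hf t ht
  constructor
  · refine ⟨hfm.aestronglyMeasurable, ?_⟩
    rw [hasFiniteIntegral_iff_ofReal hae, hl]
    exact (truncZeta_ne_top N hN r hlast).lt_top
  · rw [integral_eq_lintegral_of_nonneg_ae hae hfm.aestronglyMeasurable, hl, mzv_eq]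

/-- Kontsevich's iterated-integral representation of multiple zeta values: for
`n = (n₁, …, n_{r+1})` with all `nᵢ ≥ 1` and the last entry `≥ 2`, setting `w = n₁ + ⋯ + n_{r+1}`
and `gᵢ(t) = 1/(1-t)` if the (0-based) index `i` is one of the partial sums
`0, n₁, n₁+n₂, …, n₁+⋯+n_r` and `gᵢ(t) = 1/t` otherwise, the integral of `∏ gᵢ(tᵢ)`
over the simplex `0 < t₁ < ⋯ < t_w < 1` converges absolutely and equals ζ(n₁,…,n_{r+1}). -/
theorem stmt1 (r : ℕ) (n : Fin (r + 1) → ℕ) (hn : ∀ i, 1 ≤ n i)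
    (hlast : 2 ≤ n (Fin.last r)) :
    IntegrableOn (fun t : Fin (∑ i, n i) → ℝ =>
        ∏ i : Fin (∑ i, n i), (if ∃ j : Fin (r + 1), (i : ℕ) = ∑ k ∈ Finset.Iio j, n k
          then (1 - t i)⁻¹ else (t i)⁻¹))
      (openSimplex (∑ i, n i)) ∧
    (∫ t in openSimplex (∑ i, n i),
        ∏ i : Fin (∑ i, n i), (if ∃ j : Fin (r + 1), (i : ℕ) = ∑ k ∈ Finset.Iio j, n k
          then (1 - t i)⁻¹ else (t i)⁻¹)) = mzv n := by
  classical
  set N : ℕ → ℕ := fun k => if h : k < r + 1 then n ⟨k, h⟩ else 1 with hNdef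
  have hNn : ∀ i : Fin (r + 1), N i = n i := fun i => by
    simp only [hNdef]; rw [dif_pos i.2]
  have hN : ∀ i, 1 ≤ N i := fun i => by
    simp only [hNdef]; split_ifs
    · exact hn _
    · exact le_rfl
  have hl : 2 ≤ N r := by
    have := hNn (Fin.last r)
    rw [Fin.val_last] at this
    rw [this]; exact hlast
  have hW : ∑ i, n i = pSum N (r + 1) := by
    rw [pSum, Finset.sum_range]
    exact Finset.sum_congr rfl fun i _ => (hNn i).symm
  have hP : ∀ j : Fin (r + 1), ∑ k ∈ Finset.Iio j, n k = pSum N j := by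
    intro j
    rw [pSum, ← Nat.Iio_eq_range, ← Fin.map_valEmbedding_Iio, Finset.sum_map]
    exact Finset.sum_congr rfl fun i _ => (hNn i).symm
  have hmono : StrictMono (pSum N) := strictMono_nat_of_lt_succ fun j => by
    have h1 : pSum N (j + 1) = pSum N j + N j := Finset.sum_range_succ _ _
    have := hN j
    omega
  have hiff : ∀ i : Fin (∑ i, n i), (∃ j : Fin (r + 1), (i : ℕ) = ∑ k ∈ Finset.Iio j, n k) ↔
      ∃ j, (i : ℕ) = pSum N j := by
    intro i
    constructor
    · rintro ⟨j, hj⟩; exact ⟨j, by rw [hj, hP]⟩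
    · rintro ⟨j, hj⟩
      have h1 : pSum N j < pSum N (r + 1) := by rw [← hj, ← hW]; exact i.2
      exact ⟨⟨j, hmono.lt_iff_lt.1 h1⟩, by rw [hP]; exact hj⟩
  have hn' : n = fun i : Fin (r + 1) => N i := funext fun i => (hNn i).symm
  have hnn : ∀ t ∈ openSimplex (∑ i, n i), ∀ i : Fin (∑ i, n i),
      0 ≤ (if ∃ j : Fin (r + 1), (i : ℕ) = ∑ k ∈ Finset.Iio j, n k
          then (1 - t i)⁻¹ else (t i)⁻¹) := by
    intro t ht i
    have := ht.1 i
    split_ifs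
    · exact inv_nonneg.2 (by linarith)
    · exact inv_nonneg.2 (by linarith)
  have key := main_aux N hN r hl (∑ i, n i) hW
    (fun t => ∏ i : Fin (∑ i, n i), (if ∃ j : Fin (r + 1), (i : ℕ) = ∑ k ∈ Finset.Iio j, n k
          then (1 - t i)⁻¹ else (t i)⁻¹))
    (fun t ht => Finset.prod_nonneg fun i _ => hnn t ht i)
    (by
      refine Finset.measurable_prod _ fun i _ => ?_
      split_ifs
      · fun_prop
      · fun_prop)
    (by
      intro t ht
      rw [ENNReal.ofReal_prod_of_nonneg fun i _ => hnn t ht i]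
      refine Finset.prod_congr rfl fun i _ => ?_
      unfold letterFn
      congr 1
      exact if_congr (hiff i) rfl rfl)
  rw [show mzv n = mzv (fun i : Fin (r + 1) => N i) from congrArg mzv hn']
  convert key using 1
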